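/- arXiv:2310.00467 — 8 statements merged into one kernel-verified Lean document; each statement's English description precedes it below -/
import Mathlib

section
/- A storage system (S_1,…,S_m) of n files on m servers is an ECBC(n,m,k,t,r) if and only if for every c ∈ {1,2,…,k} and every set J of c files, the files in J are collectively stored on at least ⌈c/t⌉ + r servers, i.e., |⋃_{j∈J} F_j| ≥ ⌈c/t⌉ + r. -/
/-- An `m × n` storage system `S` (server `i` stores the files in `S i`) is an
`ECBC(n,m,k,t,r)` if for every subset `X'` of files with `|X'| ≤ k` and every set `J` of
servers with `|J| ≥ m − r`, there exist sets `C j ⊆ S j` for `j ∈ J` with `|C j| ≤ t`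
whose union is `X'`. -/
def isECBC (n m k t r : ℕ) (S : Fin m → Finset (Fin n)) : Prop :=
  ∀ X' : Finset (Fin n), X'.card ≤ k →
    ∀ J : Finset (Fin m), m - r ≤ J.card →
      ∃ C : Fin m → Finset (Fin n),
        (∀ j ∈ J, C j ⊆ S j ∧ (C j).card ≤ t) ∧ J.biUnion C = X'

/-- Hall's theorem with capacities: if every `A ⊆ X` has at least `|A| / t` neighbours, then `X`
can be assigned to neighbours so that no neighbour is used more than `t` times. -/
theorem exists_capacitated_assignment {α β : Type*} [DecidableEq α] [DecidableEq β] {t : ℕ}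
    (X : Finset α) (N : α → Finset β)
    (h : ∀ A ⊆ X, A.card ≤ (A.biUnion N).card * t) :
    ∃ C : β → Finset α, (∀ b, (C b).card ≤ t ∧ C b ⊆ X ∧ ∀ a ∈ C b, b ∈ N a) ∧
      ∀ a ∈ X, ∃ b ∈ N a, a ∈ C b := by
  obtain ⟨f, f_inj, f_mem⟩ := (Finset.all_card_le_biUnion_card_iff_exists_injective
    (fun x : X => N x ×ˢ (Finset.univ : Finset (Fin t)))).1 (by
      intro A
      have hA := h (A.map (Function.Embedding.subtype _)) (by
        intro a ha
        obtain ⟨x, -, rfl⟩ := Finset.mem_map.1 ha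
        exact x.2)
      have h_union : A.biUnion (fun x : X => N x ×ˢ (Finset.univ : Finset (Fin t))) =
          (A.map (Function.Embedding.subtype _)).biUnion N ×ˢ Finset.univ := by
        ext ⟨b, i⟩
        simp
      rw [h_union, Finset.card_product, Finset.card_univ, Fintype.card_fin]
      simpa only [Finset.card_map] using hA)
  simp only [Finset.mem_product, Finset.mem_univ, and_true] at f_mem
  refine ⟨fun b => (Finset.univ.filter fun x => (f x).1 = b).map (Function.Embedding.subtype _),
    fun b => ⟨?_, ?_, ?_⟩, fun a ha => ⟨(f ⟨a, ha⟩).1, f_mem ⟨a, ha⟩, by simp [ha]⟩⟩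
  · rw [Finset.card_map]
    calc _ ≤ (Finset.univ : Finset (Fin t)).card :=
          Finset.card_le_card_of_injOn (fun x => (f x).2) (by simp) (by
            intro x hx y hy hxy
            simp only [Finset.coe_filter, Finset.mem_univ, true_and, Set.mem_ofPred_eq] at hx hy
            exact f_inj (Prod.ext (hx.trans hy.symm) hxy))
      _ = t := by simp
  · intro a ha
    obtain ⟨x, -, rfl⟩ := Finset.mem_map.1 ha
    exact x.2
  · intro a ha
    obtain ⟨x, hx, rfl⟩ := Finset.mem_map.1 ha
    rw [← (Finset.mem_filter.1 hx).2]
    exact f_mem x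

/-- A storage system is an `ECBC(n,m,k,t,r)` iff every set `J` of `c ≤ k` files is
collectively stored on at least `⌈c/t⌉ + r` servers. -/
theorem ecbc_iff_hall_condition (n m k t r : ℕ)
    (hn : 1 ≤ n) (hm : 1 ≤ m) (hk : 1 ≤ k) (ht : 1 ≤ t) (hkn : k ≤ n)
    (S : Fin m → Finset (Fin n)) :
    isECBC n m k t r S ↔
      ∀ c ∈ Finset.Icc 1 k, ∀ J : Finset (Fin n), J.card = c →
        (c + t - 1) / t + r ≤
          (J.biUnion (fun j => Finset.univ.filter (fun i => j ∈ S i))).card := by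
  constructor
  · rintro h c hc A rfl
    rw [Finset.mem_Icc] at hc
    set U := A.biUnion (fun j => Finset.univ.filter (fun i => j ∈ S i)) with hU
    obtain ⟨R, hRU, hR⟩ := Finset.exists_subset_card_eq (Nat.min_le_right r U.card)
    obtain ⟨C, hC, hCA⟩ := h A hc.2 Rᶜ (by
      rw [Finset.card_compl, Fintype.card_fin]
      omega)
    have hA : A ⊆ (U \ R).biUnion C := by
      intro a ha
      have ha' := ha
      rw [← hCA, Finset.mem_biUnion] at ha'
      obtain ⟨i, hi, hai⟩ := ha'
      refine Finset.mem_biUnion.2 ⟨i, Finset.mem_sdiff.2 ⟨?_, Finset.mem_compl.1 hi⟩, hai⟩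
      exact Finset.mem_biUnion.2 ⟨a, ha, by simpa using (hC i hi).1 hai⟩
    have h_card : A.card ≤ (U \ R).card * t :=
      (Finset.card_le_card hA).trans (Finset.card_biUnion_le_card_mul _ _ _ fun i hi =>
        (hC i (Finset.mem_compl.2 (Finset.mem_sdiff.1 hi).2)).2)
    have h_pos : 0 < (U \ R).card := Nat.pos_of_mul_pos_right (hc.1.trans h_card)
    rw [Finset.card_sdiff_of_subset hRU] at h_card h_pos
    have h_div : (A.card + t - 1) / t ≤ U.card - R.card := by
      rw [← Nat.lt_succ_iff, Nat.div_lt_iff_lt_mul ht, Nat.succ_mul]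
      omega
    omega
  · intro h X hX J hJ
    obtain ⟨C, hC, hCX⟩ := exists_capacitated_assignment (t := t) X
      (fun a => J.filter (fun i => a ∈ S i)) (by
        intro A hA
        rcases A.eq_empty_or_nonempty with rfl | hne
        · simp
        have h_hall := h A.card
          (Finset.mem_Icc.2 ⟨hne.card_pos, (Finset.card_le_card hA).trans hX⟩) A rfl
        have h_sub : A.biUnion (fun j => Finset.univ.filter (fun i => j ∈ S i)) ⊆
            A.biUnion (fun a => J.filter (fun i => a ∈ S i)) ∪ Jᶜ := by
          intro i hi
          simp only [Finset.mem_biUnion, Finset.mem_filter, Finset.mem_union,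
            Finset.mem_compl, Finset.mem_univ, true_and] at hi ⊢
          grind
        have h_card := (Finset.card_le_card h_sub).trans (Finset.card_union_le _ _)
        rw [Finset.card_compl, Fintype.card_fin] at h_card
        have h_div : (A.card + t - 1) / t <
            (A.biUnion (fun a => J.filter (fun i => a ∈ S i))).card + 1 := by omega
        rw [Nat.div_lt_iff_lt_mul ht, Nat.succ_mul] at h_div
        omega)
    refine ⟨C, fun j _ => ⟨fun a ha => (Finset.mem_filter.1 ((hC j).2.2 a ha)).2, (hC j).1⟩, ?_⟩
    ext a
    rw [Finset.mem_biUnion]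
    constructor
    · rintro ⟨j, -, ha⟩
      exact (hC j).2.1 ha
    · intro ha
      obtain ⟨j, hj, haj⟩ := hCX a ha
      exact ⟨j, (Finset.mem_filter.1 hj).1, haj⟩
end

section
/- A storage system (S_1,…,S_m) of n files on m servers is an ECBC(n,m,k,1,r) (i.e., with t = 1) if and only if for every c ∈ {1,2,…,k} and every set J of c files, |⋃_{j∈J} F_j| ≥ c + r. -/
/-- In an `ECBC(n,m,k,1,r)`, every nonempty set `X` of at most `k` files is collectively stored
on at least `|X| + r` servers: otherwise, deleting `r` of these servers leaves too few. -/
theorem isECBC.card_add_le_card_biUnion {n m k r : ℕ} {S : Fin m → Finset (Fin n)}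
    (h : isECBC n m k 1 r S) {X : Finset (Fin n)} (hX : X.Nonempty) (hXk : X.card ≤ k) :
    X.card + r ≤ (X.biUnion (fun j => Finset.univ.filter (fun i => j ∈ S i))).card := by
  set U := X.biUnion (fun j => Finset.univ.filter (fun i => j ∈ S i))
  obtain ⟨R, hRU, hR⟩ := Finset.exists_subset_card_eq (min_le_right r U.card)
  have hRc : m - r ≤ Rᶜ.card := by
    rw [Finset.card_compl, Fintype.card_fin]
    omega
  obtain ⟨C, hC, hCX⟩ := h X hXk Rᶜ hRc
  have hsub : X ⊆ (U \ R).biUnion C := by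
    intro x hx
    obtain ⟨i, hi, hxi⟩ := Finset.mem_biUnion.1 (hCX.symm ▸ hx)
    refine Finset.mem_biUnion.2 ⟨i, Finset.mem_sdiff.2 ⟨?_, Finset.mem_compl.1 hi⟩, hxi⟩
    exact Finset.mem_biUnion.2 ⟨x, hx, by simpa using (hC i hi).1 hxi⟩
  have hcard : X.card ≤ (U \ R).card * 1 :=
    (Finset.card_le_card hsub).trans <| Finset.card_biUnion_le_card_mul _ _ _ fun i hi =>
      (hC i (Finset.mem_compl.2 (Finset.mem_sdiff.1 hi).2)).2
  rw [Finset.card_sdiff_of_subset hRU] at hcard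
  have := hX.card_pos
  omega

/-- If every nonempty set `X` of at most `k` files is collectively stored on at least `|X| + r`
servers, then Hall's theorem gives the retrieval sets of an `ECBC(n,m,k,1,r)`. -/
theorem isECBC_of_card_add_le_card_biUnion {n m k r : ℕ} {S : Fin m → Finset (Fin n)}
    (h : ∀ X : Finset (Fin n), X.Nonempty → X.card ≤ k →
      X.card + r ≤ (X.biUnion (fun j => Finset.univ.filter (fun i => j ∈ S i))).card) :
    isECBC n m k 1 r S := by
  intro X hXk J hJ
  obtain ⟨f, hf, hfJ⟩ := (Finset.all_card_le_biUnion_card_iff_exists_injective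
    (fun x : X => J.filter (fun i => (x : Fin n) ∈ S i))).1 <| by
      intro s
      rcases s.eq_empty_or_nonempty with rfl | hs
      · simp
      set Y : Finset (Fin n) := s.map (Function.Embedding.subtype _)
      have hYX : Y ⊆ X := by
        intro y hy
        obtain ⟨x, -, rfl⟩ := Finset.mem_map.1 hy
        exact x.2
      have hYs : Y.card = s.card := Finset.card_map _
      have hYh := h Y hs.map ((Finset.card_le_card hYX).trans hXk)
      have hsub : Y.biUnion (fun j => Finset.univ.filter (fun i => j ∈ S i)) ⊆
          s.biUnion (fun x : X => J.filter (fun i => (x : Fin n) ∈ S i)) ∪ Jᶜ := by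
        intro i hi
        obtain ⟨y, hy, hyi⟩ := Finset.mem_biUnion.1 hi
        obtain ⟨x, hx, rfl⟩ := Finset.mem_map.1 hy
        by_cases hiJ : i ∈ J
        · exact Finset.mem_union_left _ (Finset.mem_biUnion.2
            ⟨x, hx, Finset.mem_filter.2 ⟨hiJ, (Finset.mem_filter.1 hyi).2⟩⟩)
        · exact Finset.mem_union_right _ (Finset.mem_compl.2 hiJ)
      have hcard := (Finset.card_le_card hsub).trans (Finset.card_union_le _ _)
      rw [Finset.card_compl, Fintype.card_fin] at hcard
      omega
  refine ⟨fun i => (Finset.univ.filter (fun x : X => f x = i)).map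
    (Function.Embedding.subtype _), fun i _ => ⟨?_, ?_⟩, ?_⟩
  · intro y hy
    obtain ⟨x, hx, rfl⟩ := Finset.mem_map.1 hy
    obtain rfl := (Finset.mem_filter.1 hx).2
    exact (Finset.mem_filter.1 (hfJ x)).2
  · rw [Finset.card_map, Finset.card_le_one]
    intro a ha b hb
    exact hf ((Finset.mem_filter.1 ha).2.trans (Finset.mem_filter.1 hb).2.symm)
  · ext y
    constructor
    · intro hy
      obtain ⟨i, -, hi⟩ := Finset.mem_biUnion.1 hy
      obtain ⟨x, -, rfl⟩ := Finset.mem_map.1 hi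
      exact x.2
    · intro hy
      exact Finset.mem_biUnion.2 ⟨f ⟨y, hy⟩, (Finset.mem_filter.1 (hfJ ⟨y, hy⟩)).1,
        Finset.mem_map.2 ⟨⟨y, hy⟩, by simp, rfl⟩⟩

/-- A storage system is an `ECBC(n,m,k,1,r)` iff every set `J` of `c ≤ k` files is
collectively stored on at least `c + r` servers. -/
theorem ecbc_t_one_iff_hall_condition (n m k r : ℕ)
    (hn : 1 ≤ n) (hm : 1 ≤ m) (hk : 1 ≤ k) (hkn : k ≤ n)
    (S : Fin m → Finset (Fin n)) :
    isECBC n m k 1 r S ↔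
      ∀ c ∈ Finset.Icc 1 k, ∀ J : Finset (Fin n), J.card = c →
        c + r ≤ (J.biUnion (fun j => Finset.univ.filter (fun i => j ∈ S i))).card := by
  constructor
  · rintro h c hc J rfl
    obtain ⟨hc1, hck⟩ := Finset.mem_Icc.1 hc
    exact h.card_add_le_card_biUnion (Finset.card_pos.1 hc1) hck
  · intro h
    exact isECBC_of_card_add_le_card_biUnion fun X hX hXk =>
      h X.card (Finset.mem_Icc.2 ⟨hX.card_pos, hXk⟩) X rfl
end

section
/- A storage system (S_1,…,S_m) of n files on m servers is a CBC(n,m,k,t) (i.e., an ECBC with r = 0) if and only if for every c ∈ {1,2,…,k} and every set J of c files, |⋃_{j∈J} F_j| ≥ ⌈c/t⌉. -/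
/-- An `m × n` storage system `S` (server `i` stores the files in `S i`) is a
`CBC(n,m,k,t)` if for every subset `X'` of files with `|X'| ≤ k` there exist sets
`C i ⊆ S i` with `|C i| ≤ t` whose union is `X'`. -/
def isCBC (n m k t : ℕ) (S : Fin m → Finset (Fin n)) : Prop :=
  ∀ X' : Finset (Fin n), X'.card ≤ k →
    ∃ C : Fin m → Finset (Fin n),
      (∀ i, C i ⊆ S i ∧ (C i).card ≤ t) ∧ Finset.univ.biUnion C = X'

/-- Hall's theorem with capacities: if every finite set `s` of indices satisfies
`#s ≤ t * #(s.biUnion F)`, there is a choice of representatives using each value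
at most `t` times. -/
theorem exists_choice_card_fiber_le {ι α : Type*} [DecidableEq α] (F : ι → Finset α) (t : ℕ)
    (h : ∀ s : Finset ι, s.card ≤ t * (s.biUnion F).card) :
    ∃ f : ι → α, (∀ x, f x ∈ F x) ∧
      ∀ (s : Finset ι) (a : α), (∀ x ∈ s, f x = a) → s.card ≤ t := by
  obtain ⟨g, hg, hgF⟩ := (Finset.all_card_le_biUnion_card_iff_exists_injective
    (fun x => F x ×ˢ (Finset.univ : Finset (Fin t)))).1 (by
      intro s
      have hs : s.biUnion (fun x => F x ×ˢ (Finset.univ : Finset (Fin t))) =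
          s.biUnion F ×ˢ Finset.univ := by
        ext ⟨a, b⟩
        simp
      rw [hs, Finset.card_product, Finset.card_univ, Fintype.card_fin, mul_comm]
      exact h s)
  refine ⟨fun x => (g x).1, fun x => (Finset.mem_product.1 (hgF x)).1, fun s a hs => ?_⟩
  have hinj : Set.InjOn (fun x => (g x).2) (s : Set ι) := fun x hx y hy hxy =>
    hg (Prod.ext ((hs x hx).trans (hs y hy).symm) hxy)
  simpa using Finset.card_le_card_of_injOn (t := (Finset.univ : Finset (Fin t)))
    (fun x => (g x).2) (fun _ _ => Finset.mem_coe.2 (Finset.mem_univ _)) hinj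

/-- A storage system is a `CBC(n,m,k,t)` iff every set `J` of `c ≤ k` files is
collectively stored on at least `⌈c/t⌉` servers. -/
theorem cbc_iff_hall_condition (n m k t : ℕ)
    (hn : 1 ≤ n) (hm : 1 ≤ m) (hk : 1 ≤ k) (ht : 1 ≤ t) (hkn : k ≤ n)
    (S : Fin m → Finset (Fin n)) :
    isCBC n m k t S ↔
      ∀ c ∈ Finset.Icc 1 k, ∀ J : Finset (Fin n), J.card = c →
        (c + t - 1) / t ≤
          (J.biUnion (fun j => Finset.univ.filter (fun i => j ∈ S i))).card := by
  simp only [← Nat.ceilDiv_eq_add_pred_div, ceilDiv_le_iff_le_mul (Nat.succ_le_iff.1 ht),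
    Finset.mem_Icc]
  constructor
  · rintro h c ⟨-, hc⟩ J rfl
    obtain ⟨C, hC, hJ⟩ := h J hc
    have hsub : J ⊆ (J.biUnion fun j => Finset.univ.filter fun i => j ∈ S i).biUnion C := by
      intro j hj
      obtain ⟨i, -, hi⟩ := Finset.mem_biUnion.1 (hJ.symm ▸ hj)
      exact Finset.mem_biUnion.2 ⟨i, Finset.mem_biUnion.2
        ⟨j, hj, Finset.mem_filter.2 ⟨Finset.mem_univ i, (hC i).1 hi⟩⟩, hi⟩
    rw [mul_comm]
    exact (Finset.card_le_card hsub).trans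
      (Finset.card_biUnion_le_card_mul _ _ _ fun i _ => (hC i).2)
  · intro h X hX
    obtain ⟨f, hfS, hft⟩ := exists_choice_card_fiber_le
      (fun j : X => Finset.univ.filter fun i => (j : Fin n) ∈ S i) t (by
        intro s
        rcases s.eq_empty_or_nonempty with rfl | hs
        · simp
        · have hcard : (s.map (Function.Embedding.subtype (· ∈ X))).card = s.card :=
            Finset.card_map _
          have hsX : s.card ≤ X.card := by simpa using s.card_le_univ
          have hall := h s.card ⟨hs.card_pos, hsX.trans hX⟩ _ hcard
          rwa [Finset.map_eq_image, Finset.image_biUnion] at hall)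
    refine ⟨fun i => (Finset.univ.filter fun j => f j = i).map
      (Function.Embedding.subtype (· ∈ X)), fun i => ⟨?_, ?_⟩, ?_⟩
    · intro j hj
      obtain ⟨x, hx, rfl⟩ := Finset.mem_map.1 hj
      exact (Finset.mem_filter.1 hx).2 ▸ (Finset.mem_filter.1 (hfS x)).2
    · rw [Finset.card_map]
      exact hft _ i fun x hx => (Finset.mem_filter.1 hx).2
    · ext j
      simp
end

section
/- If m = k and n ≥ m, then the minimum total storage over all CBC(n,m,k,1) systems equals kn − k(k−1); that is, there exists a CBC(n,k,k,1) with total storage kn − k(k−1), and every CBC(n,k,k,1) has total storage at least kn − k(k−1). -/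
/-- A system is a `CBC(n,m,k,1)` as soon as every set of at most `k` files can be assigned
injectively to servers storing them. -/
lemma isCBC_one_of_exists_injOn {n m k : ℕ} {S : Fin m → Finset (Fin n)}
    (h : ∀ X : Finset (Fin n), X.card ≤ k →
      ∃ g : Fin n → Fin m, Set.InjOn g X ∧ ∀ x ∈ X, x ∈ S (g x)) :
    isCBC n m k 1 S := by
  intro X hX
  obtain ⟨g, hinj, hmem⟩ := h X hX
  refine ⟨fun i => X.filter (g · = i), fun i => ⟨fun x hx => ?_, ?_⟩, ?_⟩
  · obtain ⟨hxX, rfl⟩ := Finset.mem_filter.1 hx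
    exact hmem x hxX
  · refine Finset.card_le_one.2 fun x hx y hy => ?_
    rw [Finset.mem_filter] at hx hy
    exact hinj hx.1 hy.1 (hx.2.trans hy.2.symm)
  · ext x
    simp

/-- In a `CBC(n,k,k,1)`, fewer than `k` files are missing from each server. -/
lemma card_compl_lt_of_isCBC {n k : ℕ} {S : Fin k → Finset (Fin n)}
    (hS : isCBC n k k 1 S) (i : Fin k) : (S i)ᶜ.card < k := by
  by_contra! hle
  obtain ⟨X, hXS, hXk⟩ := Finset.exists_subset_card_eq hle
  obtain ⟨C, hC, hU⟩ := hS X hXk.le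
  have hCi : C i = ∅ := by
    refine Finset.eq_empty_of_forall_notMem fun x hx => ?_
    have hxX : x ∈ X := hU ▸ Finset.mem_biUnion.2 ⟨i, Finset.mem_univ i, hx⟩
    exact Finset.mem_compl.1 (hXS hxX) ((hC i).1 hx)
  have hlt : ∑ j, (C j).card < ∑ _j : Fin k, 1 :=
    Finset.sum_lt_sum (fun j _ => (hC j).2) ⟨i, Finset.mem_univ i, by simp [hCi]⟩
  have hle' : X.card ≤ ∑ j, (C j).card := hU ▸ Finset.card_biUnion_le
  simp at hlt
  omega

/-- Server `i` stores the file `i` and all files from `k` on. -/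
def privateFileSystem (n k : ℕ) (i : Fin k) : Finset (Fin n) :=
  Finset.univ.filter fun x => x.val = i.val ∨ k ≤ x.val

lemma card_privateFileSystem {n k : ℕ} (hkn : k ≤ n) (i : Fin k) :
    (privateFileSystem n k i).card = n - (k - 1) := by
  have hmap : (privateFileSystem n k i).map Fin.valEmbedding =
      insert i.val (Finset.Ico k n) := by
    ext x
    simp only [privateFileSystem, Finset.mem_map, Finset.mem_filter, Finset.mem_univ, true_and,
      Fin.valEmbedding_apply, Finset.mem_insert, Finset.mem_Ico]
    constructor
    · rintro ⟨y, hy, rfl⟩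
      have := y.isLt
      omega
    · intro hx
      exact ⟨⟨x, by omega⟩, by simp; omega, rfl⟩
  rw [← Finset.card_map Fin.valEmbedding, hmap, Finset.card_insert_of_notMem (by simp),
    Nat.card_Ico]
  have := i.isLt
  omega

lemma isCBC_privateFileSystem {n k : ℕ} (hk : 1 ≤ k) (hkn : k ≤ n) :
    isCBC n k k 1 (privateFileSystem n k) := by
  refine isCBC_one_of_exists_injOn fun X hX => ?_
  have : Nonempty (Fin k) := ⟨⟨0, hk⟩⟩
  set free : Finset (Fin k) := Finset.univ.filter fun i => Fin.castLE hkn i ∉ X with hfree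
  set shared : Finset (Fin n) := X.filter fun x => ¬ x.val < k with hshared
  have hlow : (Finset.univ.filter fun i : Fin k => Fin.castLE hkn i ∈ X).card =
      (X.filter fun x => x.val < k).card := by
    rw [← Finset.card_map (Fin.castLEEmb hkn)]
    congr 1
    ext x
    simp only [Finset.mem_map, Finset.mem_filter, Finset.mem_univ, true_and,
      Fin.castLEEmb_apply]
    constructor
    · rintro ⟨i, hi, rfl⟩
      exact ⟨hi, i.isLt⟩
    · rintro ⟨hx, hxk⟩
      exact ⟨⟨x, hxk⟩, hx, rfl⟩
  have hcard : shared.card ≤ free.card := by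
    have h₁ := Finset.card_filter_add_card_filter_not (s := X) fun x => x.val < k
    have h₂ := Finset.card_filter_add_card_filter_not (s := (Finset.univ : Finset (Fin k)))
      fun i => Fin.castLE hkn i ∈ X
    rw [Finset.card_univ, Fintype.card_fin] at h₂
    rw [hshared, hfree]
    omega
  obtain ⟨f, hf, hinj⟩ := shared.finite_toSet.exists_injOn_of_encard_le
    (t := (free : Set (Fin k))) (by simpa using hcard)
  have hfX : ∀ x ∈ X, ¬ x.val < k → Fin.castLE hkn (f x) ∉ X := fun x hx hxk => by
    have := hf (show x ∈ (shared : Set (Fin n)) by simp [hshared, hx]; omega)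
    simpa [hfree] using this
  refine ⟨fun x => if h : x.val < k then ⟨x, h⟩ else f x, fun x hx y hy hxy => ?_,
    fun x _ => ?_⟩
  · rw [Finset.mem_coe] at hx hy
    by_cases hxk : x.val < k <;> by_cases hyk : y.val < k <;> simp only [hxk, hyk, dite_true,
      dite_false] at hxy
    · exact Fin.ext (Fin.mk.inj hxy)
    · exact absurd hx (by simpa [← hxy] using hfX y hy hyk)
    · exact absurd hy (by simpa [hxy] using hfX x hx hxk)
    · exact hinj (by simp [hshared, hx]; omega) (by simp [hshared, hy]; omega) hxy
  · by_cases hxk : x.val < k <;> simp [privateFileSystem, hxk]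
    omega

/-- If `m = k` and `n ≥ m`, the minimum total storage over all `CBC(n,m,k,1)` systems
equals `k·n − k·(k−1)`. -/
theorem cbc_min_storage_m_eq_k (n m k : ℕ)
    (hk : 1 ≤ k) (hkm : k ≤ m) (hmn : m ≤ n) (hmk : m = k) :
    (∃ S : Fin m → Finset (Fin n), isCBC n m k 1 S ∧
        ∑ i, (S i).card = k * n - k * (k - 1)) ∧
    (∀ S : Fin m → Finset (Fin n), isCBC n m k 1 S →
        k * n - k * (k - 1) ≤ ∑ i, (S i).card) := by
  subst hmk
  rw [← Nat.mul_sub]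
  refine ⟨⟨privateFileSystem n m, isCBC_privateFileSystem hk hmn, ?_⟩, fun S hS => ?_⟩
  · simp [card_privateFileSystem hmn]
  · have hcard : ∀ i ∈ Finset.univ, n - (m - 1) ≤ (S i).card := fun i _ => by
      have hlt := card_compl_lt_of_isCBC hS i
      rw [Finset.card_compl, Fintype.card_fin] at hlt
      omega
    simpa using Finset.card_nsmul_le_sum _ _ _ hcard
end

section
/- If n = m + 1 and k ≤ m, then the minimum total storage over all CBC(n,m,k,1) systems equals m + k; that is, there exists a CBC(m+1,m,k,1) with total storage m + k, and every CBC(m+1,m,k,1) has total storage at least m + k. -/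
/-- The servers that store at least one file of `X`. -/
def storingServers {n m : ℕ} (S : Fin m → Finset (Fin n)) (X : Finset (Fin n)) :
    Finset (Fin m) :=
  {i | (S i ∩ X).Nonempty}

theorem mem_storingServers {n m : ℕ} {S : Fin m → Finset (Fin n)} {X : Finset (Fin n)}
    {i : Fin m} : i ∈ storingServers S X ↔ ∃ x ∈ S i, x ∈ X := by
  simp [storingServers, Finset.Nonempty]

/-- Hall's condition, necessary for a CBC. -/
theorem isCBC.card_le_card_storingServers {n m k : ℕ} {S : Fin m → Finset (Fin n)}
    (hS : isCBC n m k 1 S) {X : Finset (Fin n)} (hX : X.card ≤ k) :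
    X.card ≤ (storingServers S X).card := by
  obtain ⟨C, hC, hU⟩ := hS X hX
  have hsub : X ⊆ (storingServers S X).biUnion C := by
    intro x hx
    obtain ⟨i, -, hi⟩ := Finset.mem_biUnion.1 (hU.symm ▸ hx)
    exact Finset.mem_biUnion.2 ⟨i, mem_storingServers.2 ⟨x, (hC i).1 hi, hx⟩, hi⟩
  calc X.card ≤ ((storingServers S X).biUnion C).card := Finset.card_le_card hsub
    _ ≤ (storingServers S X).card * 1 :=
      Finset.card_biUnion_le_card_mul _ _ _ fun i _ => (hC i).2
    _ = _ := mul_one _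

theorem isCBC.card_le_sum_card_sdiff {n m k : ℕ} {S : Fin m → Finset (Fin n)}
    (hS : isCBC n m k 1 S) (hk : 1 ≤ k) (X : Finset (Fin n)) :
    Xᶜ.card ≤ ∑ i, (S i \ X).card := by
  refine le_trans (Finset.card_le_card fun x hx => ?_) Finset.card_biUnion_le
  obtain ⟨C, hC, hU⟩ := hS {x} (by simpa using hk)
  obtain ⟨i, -, hi⟩ := Finset.mem_biUnion.1 (hU.symm ▸ Finset.mem_singleton_self x)
  exact Finset.mem_biUnion.2 ⟨i, Finset.mem_univ i,
    Finset.mem_sdiff.2 ⟨(hC i).1 hi, Finset.mem_compl.1 hx⟩⟩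

/-- In a minimal set of files violating Hall's condition the deficiency is one, and each
server storing one of its files stores at least two of them. -/
theorem exists_violator_two_le_card_inter {n m : ℕ} (hmn : m < n)
    (S : Fin m → Finset (Fin n)) :
    ∃ X : Finset (Fin n), (storingServers S X).card + 1 = X.card ∧
      ∀ i ∈ storingServers S X, 2 ≤ (S i ∩ X).card := by
  have huniv : (storingServers S Finset.univ).card < (Finset.univ : Finset (Fin n)).card := by
    refine lt_of_le_of_lt (Finset.card_le_univ _) ?_
    simpa using hmn
  obtain ⟨X, -, hX⟩ := exists_minimal_le_of_wellFoundedLT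
    (fun X : Finset (Fin n) => (storingServers S X).card < X.card) Finset.univ huniv
  have herase : ∀ x ∈ X, X.card ≤ (storingServers S (X.erase x)).card + 1 := by
    intro x hx
    have h := hX.not_prop_of_lt (Finset.erase_ssubset hx)
    have := Finset.card_erase_add_one hx
    lia
  have hmono : ∀ x, storingServers S (X.erase x) ⊆ storingServers S X := by
    intro x i hi
    obtain ⟨y, hy, hyX⟩ := mem_storingServers.1 hi
    exact mem_storingServers.2 ⟨y, hy, Finset.mem_of_mem_erase hyX⟩
  have hlt := hX.prop
  obtain ⟨x₀, hx₀⟩ : X.Nonempty := Finset.card_pos.1 (by lia)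
  have hcard : (storingServers S X).card + 1 = X.card := by
    have h₁ := herase x₀ hx₀
    have h₂ := Finset.card_le_card (hmono x₀)
    lia
  refine ⟨X, hcard, fun i hi => ?_⟩
  obtain ⟨x, hxS, hxX⟩ := mem_storingServers.1 hi
  have heq : storingServers S (X.erase x) = storingServers S X :=
    Finset.eq_of_subset_of_card_le (hmono x) (by have := herase x hxX; lia)
  obtain ⟨y, hyS, hyX⟩ := mem_storingServers.1 (heq.symm ▸ hi)
  exact Finset.one_lt_card.2 ⟨x, Finset.mem_inter.2 ⟨hxS, hxX⟩, y,
    Finset.mem_inter.2 ⟨hyS, Finset.mem_of_mem_erase hyX⟩, (Finset.ne_of_mem_erase hyX).symm⟩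

theorem isCBC.add_le_sum_card {m k : ℕ} {S : Fin m → Finset (Fin (m + 1))}
    (hS : isCBC (m + 1) m k 1 S) (hk : 1 ≤ k) : m + k ≤ ∑ i, (S i).card := by
  obtain ⟨X, hcard, htwo⟩ := exists_violator_two_le_card_inter (Nat.lt_succ_self m) S
  have hkX : k < X.card := by
    by_contra! h
    have := hS.card_le_card_storingServers h
    lia
  have hin : (storingServers S X).card * 2 ≤ ∑ i, (S i ∩ X).card :=
    (Finset.card_nsmul_le_sum _ _ 2 htwo).trans
      (Finset.sum_le_sum_of_subset (Finset.subset_univ _))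
  have hout := hS.card_le_sum_card_sdiff hk X
  have hsplit : ∑ i, (S i).card = ∑ i, (S i ∩ X).card + ∑ i, (S i \ X).card := by
    rw [← Finset.sum_add_distrib]
    exact Finset.sum_congr rfl fun i _ => (Finset.card_inter_add_card_sdiff _ _).symm
  have hcompl : X.card + Xᶜ.card = m + 1 := by
    simp
  lia

/-- Server `i` stores files `i` and `i + 1` if `i < k`, and only file `i + 1` otherwise. -/
def pathStorage (m k : ℕ) (i : Fin m) : Finset (Fin (m + 1)) :=
  if (i : ℕ) < k then {i.castSucc, i.succ} else {i.succ}

theorem isCBC_pathStorage {m k : ℕ} (hkm : k ≤ m) :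
    isCBC (m + 1) m k 1 (pathStorage m k) := by
  intro X hX
  obtain ⟨j, hj, hjX⟩ : ∃ j ∈ Finset.Iic (Fin.ofNat (m + 1) k), j ∉ X := by
    refine Finset.exists_mem_notMem_of_card_lt_card ?_
    rw [Fin.card_Iic, Fin.val_ofNat, Nat.mod_eq_of_lt (by lia)]
    lia
  have hjk : (j : ℕ) ≤ k := by
    have h := Fin.le_def.1 (Finset.mem_Iic.1 hj)
    rwa [Fin.val_ofNat, Nat.mod_eq_of_lt (by lia)] at h
  refine ⟨fun i => {j.succAbove i} ∩ X, fun i => ⟨fun x hx => ?_, ?_⟩, ?_⟩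
  · obtain rfl := Finset.mem_singleton.1 (Finset.mem_inter.1 hx).1
    by_cases hij : i.castSucc < j
    · have hik : (i : ℕ) < k := (show (i : ℕ) < j from hij).trans_le hjk
      simp [pathStorage, hik, Fin.succAbove_of_castSucc_lt _ _ hij]
    · rw [Fin.succAbove_of_le_castSucc _ _ (not_lt.1 hij), pathStorage]
      split_ifs <;> simp
  · exact (Finset.card_le_card Finset.inter_subset_left).trans (Finset.card_singleton _).le
  · ext x
    simp only [Finset.mem_biUnion, Finset.mem_univ, true_and, Finset.mem_inter,
      Finset.mem_singleton]
    refine ⟨fun ⟨_, _, hx⟩ => hx, fun hx => ?_⟩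
    obtain ⟨i, hi⟩ := Fin.exists_succAbove_eq (ne_of_mem_of_not_mem hx hjX)
    exact ⟨i, hi.symm, hx⟩

theorem sum_card_pathStorage {m k : ℕ} (hkm : k ≤ m) :
    ∑ i, (pathStorage m k i).card = m + k := by
  have hcard (i : Fin m) : (pathStorage m k i).card = 1 + if (i : ℕ) < k then 1 else 0 := by
    unfold pathStorage
    split_ifs
    · exact Finset.card_pair Fin.castSucc_lt_succ.ne
    · simp
  simp only [hcard, Finset.sum_add_distrib, Finset.sum_const, Finset.card_univ,
    Fintype.card_fin, smul_eq_mul, mul_one, Finset.sum_boole, Nat.cast_id, Nat.add_left_cancel_iff]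
  rw [Fin.card_filter_val_lt, min_eq_right hkm]

/-- If `n = m + 1` and `k ≤ m`, the minimum total storage over all `CBC(n,m,k,1)`
systems equals `m + k`. -/
theorem cbc_min_storage_n_eq_m_add_one (n m k : ℕ)
    (hk : 1 ≤ k) (hkm : k ≤ m) (hmn : m ≤ n) (hnm : n = m + 1) :
    (∃ S : Fin m → Finset (Fin n), isCBC n m k 1 S ∧ ∑ i, (S i).card = m + k) ∧
    (∀ S : Fin m → Finset (Fin n), isCBC n m k 1 S → m + k ≤ ∑ i, (S i).card) := by
  subst hnm
  exact ⟨⟨pathStorage m k, isCBC_pathStorage hkm, sum_card_pathStorage hkm⟩,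
    fun S hS => hS.add_le_sum_card hk⟩
end

section
/- If k ≤ m and n ≥ (k−1)·C(m,k−1), then the minimum total storage over all CBC(n,m,k,1) systems equals kn − (k−1)·C(m,k−1); that is, a CBC(n,m,k,1) with this total storage exists, and no CBC(n,m,k,1) has smaller total storage. Here C(m,k−1) denotes the binomial coefficient. -/
open Finset in
/-- Double counting: the total storage is the sum over the files of the number of servers
storing them. -/
lemma sum_card_eq_sum_card_servers {n m : ℕ} (S : Fin m → Finset (Fin n)) :
    ∑ i, #(S i) = ∑ j, #{i | j ∈ S i} := by
  simp only [card_filter]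
  rw [sum_comm]
  simp

open Finset in
/-- A set of fewer than `k` elements has at least `k - #T` supersets of size `k - 1`. -/
lemma sub_card_le_card_supersets {α : Type*} [Fintype α] [DecidableEq α] {k : ℕ}
    (hk : k ≤ Fintype.card α) (T : Finset α) :
    k - #T ≤ #{A ∈ powersetCard (k - 1) univ | T ⊆ A} := by
  rcases le_total k #T with h | h
  · simp [Nat.sub_eq_zero_of_le h]
  obtain ⟨B, hTB, -, hB⟩ := exists_subsuperset_card_eq (subset_univ T) h (by simpa using hk)
  rw [← hB, ← card_sdiff_of_subset hTB]
  refine card_le_card_of_injOn B.erase (fun b hb ↦ ?_)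
    ((erase_injOn B).mono (by simp))
  obtain ⟨hbB, hbT⟩ := mem_sdiff.1 (mem_coe.1 hb)
  simp only [coe_filter, mem_powersetCard, subset_univ, true_and, Set.mem_ofPred_eq]
  exact ⟨by rw [card_erase_of_mem hbB], subset_erase.2 ⟨hTB, hbT⟩⟩

open Finset in
/-- In a `CBC(n,m,k,1)`, at most `k - 1` files are stored only on servers of a given set of
`k - 1` servers. -/
lemma isCBC.card_files_le {n m k : ℕ} (hk : 1 ≤ k) {S : Fin m → Finset (Fin n)}
    (hS : isCBC n m k 1 S) {A : Finset (Fin m)} (hA : #A = k - 1) :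
    #{j | ({i | j ∈ S i} : Finset (Fin m)) ⊆ A} ≤ k - 1 := by
  by_contra! h
  obtain ⟨X, hXsub, hX⟩ := exists_subset_card_eq (Nat.le_of_pred_lt (m := k) h)
  obtain ⟨C, hC, hCX⟩ := hS X hX.le
  have hsub : X ⊆ A.biUnion C := by
    intro x hx
    obtain ⟨i, -, hi⟩ := mem_biUnion.1 (hCX.symm ▸ hx)
    have hxA := (mem_filter.1 (hXsub hx)).2
    exact mem_biUnion.2 ⟨i, hxA (by simpa using (hC i).1 hi), hi⟩
  have := (card_le_card hsub).trans (card_biUnion_le_card_mul A C 1 fun i _ ↦ (hC i).2)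
  omega

open Finset in
lemma isCBC.le_sum_card {n m k : ℕ} (hk : 1 ≤ k) (hkm : k ≤ m) {S : Fin m → Finset (Fin n)}
    (hS : isCBC n m k 1 S) :
    k * n - (k - 1) * m.choose (k - 1) ≤ ∑ i, #(S i) := by
  have hcount : ∑ j : Fin n, (k - #{i | j ∈ S i}) ≤ (k - 1) * m.choose (k - 1) := calc
    _ ≤ ∑ j : Fin n, #{A ∈ powersetCard (k - 1) univ | ({i | j ∈ S i} : Finset (Fin m)) ⊆ A} :=
      sum_le_sum fun j _ ↦ sub_card_le_card_supersets (by simpa using hkm) _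
    _ = ∑ A ∈ powersetCard (k - 1) univ, #{j | ({i | j ∈ S i} : Finset (Fin m)) ⊆ A} := by
      simp only [card_filter]
      exact sum_comm
    _ ≤ ∑ A ∈ powersetCard (k - 1) (univ : Finset (Fin m)), (k - 1) :=
      sum_le_sum fun A hA ↦ hS.card_files_le hk (mem_powersetCard.1 hA).2
    _ = _ := by simp [mul_comm]
  have hsum : k * n ≤ ∑ j : Fin n, (k - #{i | j ∈ S i}) + ∑ j : Fin n, #{i | j ∈ S i} := by
    rw [← sum_add_distrib]
    calc k * n = ∑ _j : Fin n, k := by simp [mul_comm]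
      _ ≤ _ := sum_le_sum fun j _ ↦ by omega
  rw [sum_card_eq_sum_card_servers]
  omega

open Finset in
/-- If any at most `k` files are together stored on at least as many servers, the system is a
`CBC(n,m,k,1)`. -/
lemma isCBC_of_card_le_card_biUnion {n m k : ℕ} (T : Fin n → Finset (Fin m))
    (hT : ∀ s : Finset (Fin n), #s ≤ k → #s ≤ #(s.biUnion T)) :
    isCBC n m k 1 fun i ↦ {j | i ∈ T j} := by
  intro X hX
  obtain ⟨f, hf, hfT⟩ := (all_card_le_biUnion_card_iff_exists_injective
    fun x : X ↦ T x).1 fun s ↦ by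
      have := hT (s.map (Function.Embedding.subtype _)) ((card_le_card (t := X) (by
        intro x hx
        obtain ⟨y, -, rfl⟩ := mem_map.1 hx
        exact y.2)).trans hX)
      rwa [card_map, map_eq_image, image_biUnion] at this
  refine ⟨fun i ↦ ({x : X | f x = i} : Finset X).map (Function.Embedding.subtype _),
    fun i ↦ ⟨?_, ?_⟩, ?_⟩
  · intro x hx
    obtain ⟨y, hy, rfl⟩ := mem_map.1 hx
    simpa [(mem_filter.1 hy).2] using hfT y
  · rw [card_map]
    refine card_le_one.2 fun x hx y hy ↦ hf ?_
    rw [(mem_filter.1 hx).2, (mem_filter.1 hy).2]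
  · ext x
    simp

open Finset in
/-- If every file is stored on at least `k - 1` servers and no set of `k - 1` servers is the set
of servers of more than `k - 1` files, the system is a `CBC(n,m,k,1)`. -/
lemma isCBC_of_card_fiber_le {n m k : ℕ} (hk : 1 ≤ k) (T : Fin n → Finset (Fin m))
    (hcard : ∀ j, k - 1 ≤ #(T j)) (hfib : ∀ A, #A = k - 1 → #{j | T j = A} ≤ k - 1) :
    isCBC n m k 1 fun i ↦ {j | i ∈ T j} := by
  refine isCBC_of_card_le_card_biUnion T fun s hs ↦ ?_
  by_contra! hlt
  obtain ⟨x, hx⟩ : s.Nonempty := card_pos.1 (by omega)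
  have hxU := (hcard x).trans (card_le_card (subset_biUnion_of_mem T hx))
  have hsub : s ⊆ ({j | T j = s.biUnion T} : Finset (Fin n)) := fun y hy ↦ by
    simp only [mem_filter, mem_univ, true_and]
    exact eq_of_subset_of_card_le (subset_biUnion_of_mem T hy) (by have := hcard y; omega)
  have := (card_le_card hsub).trans (hfib _ (by omega))
  omega

open Finset in
/-- Using every set of `k - 1` servers for `k - 1` files, and a fixed set of `k` servers for the
remaining files, gives a `CBC(n,m,k,1)`. -/
lemma exists_isCBC_sum_card_eq {n m k : ℕ} (hk : 1 ≤ k) (hkm : k ≤ m)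
    (hn : (k - 1) * m.choose (k - 1) ≤ n) :
    ∃ S : Fin m → Finset (Fin n), isCBC n m k 1 S ∧
      ∑ i, #(S i) = k * n - (k - 1) * m.choose (k - 1) := by
  let P := powersetCard (k - 1) (univ : Finset (Fin m)) × Fin (k - 1)
  have hP : Fintype.card P = (k - 1) * m.choose (k - 1) := by simp [P, mul_comm]
  obtain ⟨φ⟩ : Nonempty (P ↪ Fin n) :=
    Function.Embedding.nonempty_of_card_le (by simpa [hP] using hn)
  obtain ⟨B, -, hB⟩ := exists_subset_card_eq
    (show k ≤ #(univ : Finset (Fin m)) by simpa using hkm)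
  let T : Fin n → Finset (Fin m) := Function.extend φ (fun p ↦ p.1.1) fun _ ↦ B
  have hTφ (p : P) : T (φ p) = p.1.1 := φ.injective.extend_apply _ _ p
  have hTB (j : Fin n) (hj : ¬ ∃ p, φ p = j) : T j = B := Function.extend_apply' _ _ j hj
  have hTcard (p : P) : #(T (φ p)) = k - 1 := by
    rw [hTφ]
    exact (mem_powersetCard.1 p.1.2).2
  refine ⟨fun i ↦ {j | i ∈ T j}, isCBC_of_card_fiber_le hk T (fun j ↦ ?_) fun A hA ↦ ?_, ?_⟩
  · by_cases hj : ∃ p, φ p = j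
    · obtain ⟨p, rfl⟩ := hj
      exact (hTcard p).ge
    · rw [hTB j hj]
      omega
  · let a : powersetCard (k - 1) (univ : Finset (Fin m)) :=
      ⟨A, mem_powersetCard.2 ⟨subset_univ _, hA⟩⟩
    have hsub : ({j | T j = A} : Finset (Fin n)) ⊆ univ.image fun c ↦ φ (a, c) := by
      intro j hj
      have hjA := (mem_filter.1 hj).2
      by_cases hj : ∃ p, φ p = j
      · obtain ⟨⟨b, c⟩, rfl⟩ := hj
        obtain rfl : b = a := Subtype.ext ((hTφ (b, c)).symm.trans hjA)
        exact mem_image_of_mem _ (mem_univ c)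
      · rw [hTB j hj] at hjA
        subst hjA
        omega
    simpa using (card_le_card hsub).trans card_image_le
  · have hsum : ∑ j, #(T j) + (k - 1) * m.choose (k - 1) = k * n := calc
      _ = ∑ j, #(T j) + ∑ j, if j ∈ univ.map φ then 1 else 0 := by
        rw [← card_filter, filter_mem_eq_inter, univ_inter, card_map, card_univ, hP]
      _ = ∑ _j : Fin n, k := by
        rw [← sum_add_distrib]
        refine sum_congr rfl fun j _ ↦ ?_
        by_cases hj : ∃ p, φ p = j
        · rw [if_pos (by simpa using hj)]
          obtain ⟨p, rfl⟩ := hj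
          rw [hTcard]
          omega
        · rw [if_neg (by simpa using hj), hTB j hj, hB, add_zero]
      _ = k * n := by simp [mul_comm]
    rw [sum_card_eq_sum_card_servers]
    simp only [mem_filter, mem_univ, true_and, filter_univ_mem]
    omega

/-- If `k ≤ m` and `n ≥ (k−1)·C(m,k−1)`, the minimum total storage over all
`CBC(n,m,k,1)` systems equals `k·n − (k−1)·C(m,k−1)`. -/
theorem cbc_min_storage_large_n (n m k : ℕ)
    (hk : 1 ≤ k) (hkm : k ≤ m) (hmn : m ≤ n)
    (hn : (k - 1) * Nat.choose m (k - 1) ≤ n) :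
    (∃ S : Fin m → Finset (Fin n), isCBC n m k 1 S ∧
        ∑ i, (S i).card = k * n - (k - 1) * Nat.choose m (k - 1)) ∧
    (∀ S : Fin m → Finset (Fin n), isCBC n m k 1 S →
        k * n - (k - 1) * Nat.choose m (k - 1) ≤ ∑ i, (S i).card) :=
  ⟨exists_isCBC_sum_card_eq hk hkm hn, fun _ hS ↦ hS.le_sum_card hk hkm⟩
end

section
/- If 2 ≤ k ≤ m and C(m,k−2) ≤ n ≤ (k−1)·C(m,k−1), then the minimum total storage over all CBC(n,m,k,1) systems equals n(k−1) − ⌊((k−1)·C(m,k−1) − n)/(m−k+1)⌋; that is, a CBC(n,m,k,1) with this total storage exists, and no CBC(n,m,k,1) has smaller total storage. Here C(·,·) denotes the binomial coefficient. -/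
open Finset

/-- Double counting of the incidences between servers and files. -/
theorem sum_card_filter_mem_comm {ι κ : Type*} [Fintype ι] [Fintype κ] [DecidableEq ι]
    (B : κ → Finset ι) : ∑ i, #{x | i ∈ B x} = ∑ x, #(B x) := by
  have h := sum_card_bipartiteAbove_eq_sum_card_bipartiteBelow
    (s := (univ : Finset ι)) (t := (univ : Finset κ)) (fun i x => i ∈ B x)
  simpa [bipartiteAbove, bipartiteBelow] using h

/-- In a batch code, fewer than `k` servers cannot hold all copies of more files than
there are servers. -/
theorem isCBC.card_filter_subset_le {n m k : ℕ} {S : Fin m → Finset (Fin n)}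
    (hS : isCBC n m k 1 S) (A : Finset (Fin m)) (hA : #A < k) :
    #{x : Fin n | ({i | x ∈ S i} : Finset (Fin m)) ⊆ A} ≤ #A := by
  by_contra! hlt
  obtain ⟨X, hXsub, hX⟩ := exists_subset_card_eq (Nat.succ_le_of_lt hlt)
  obtain ⟨C, hC, hCX⟩ := hS X (by omega)
  have hcover : X ⊆ A.biUnion C := by
    intro x hx
    have hx' := hx
    rw [← hCX] at hx'
    obtain ⟨i, -, hi⟩ := mem_biUnion.1 hx'
    exact mem_biUnion.2 ⟨i, (mem_filter.1 (hXsub hx)).2 (by simpa using (hC i).1 hi), hi⟩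
  have h := (card_le_card hcover).trans (card_biUnion_le_card_mul A C 1 fun i _ => (hC i).2)
  omega

/-- Hall's condition for the blocks of a storage system yields a batch code. -/
theorem isCBC_of_card_filter_subset_le {n m k : ℕ} (B : Fin n → Finset (Fin m))
    (hB : ∀ A : Finset (Fin m), #A < k → #{x | B x ⊆ A} ≤ #A) :
    isCBC n m k 1 fun i => {x | i ∈ B x} := by
  intro X hX
  have hall : ∀ s : Finset X, #s ≤ #(s.biUnion fun x => B x) := by
    intro s
    by_contra! hlt
    have hsX : #s ≤ #X := by simpa using card_le_univ s
    have h := hB (s.biUnion fun x => B x) (by omega)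
    have hs : s.map (Function.Embedding.subtype _) ⊆
        ({x | B x ⊆ s.biUnion fun x => B x} : Finset (Fin n)) := by
      intro x hx
      obtain ⟨y, hy, rfl⟩ := mem_map.1 hx
      exact mem_filter.2 ⟨mem_univ _, subset_biUnion_of_mem (fun x : X => B x) hy⟩
    have h' := card_le_card hs
    rw [card_map] at h'
    omega
  obtain ⟨f, hf, hfB⟩ := (all_card_le_biUnion_card_iff_exists_injective _).1 hall
  refine ⟨fun i => ({x | f x = i} : Finset X).map (Function.Embedding.subtype _), ?_, ?_⟩
  · refine fun i => ⟨?_, ?_⟩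
    · intro x hx
      obtain ⟨y, hy, rfl⟩ := mem_map.1 hx
      have hy' := (mem_filter.1 hy).2
      subst hy'
      simpa using hfB y
    · rw [card_map, card_le_one]
      intro a ha b hb
      exact hf ((mem_filter.1 ha).2.trans (mem_filter.1 hb).2.symm)
  · ext x
    simp

/-- A finite family of blocks satisfying Hall's condition gives a batch code whose total
storage is the sum of the block sizes. -/
theorem exists_isCBC_of_blocks {ι : Type*} [Fintype ι] {n m k : ℕ} (hι : Fintype.card ι = n)
    (B : ι → Finset (Fin m))
    (hB : ∀ A : Finset (Fin m), #A < k → #{x | B x ⊆ A} ≤ #A) :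
    ∃ S : Fin m → Finset (Fin n), isCBC n m k 1 S ∧ ∑ i, #(S i) = ∑ x, #(B x) := by
  let e : Fin n ≃ ι := (Fintype.equivFinOfCardEq hι).symm
  refine ⟨_, isCBC_of_card_filter_subset_le (fun x => B (e x)) ?_, ?_⟩
  · intro A hA
    refine le_trans ?_ (hB A hA)
    refine card_le_card_of_injOn e ?_ e.injective.injOn
    intro x hx
    simpa using hx
  · rw [sum_card_filter_mem_comm]
    exact e.sum_comp fun x => #(B x)

/-- The number of `r`-subsets containing a given set. -/
theorem card_filter_subset_powersetCard {α : Type*} [Fintype α] [DecidableEq α] (t : Finset α)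
    {r : ℕ} (hr : #t ≤ r) :
    #{A ∈ powersetCard r univ | t ⊆ A} = (Fintype.card α - #t).choose (r - #t) := by
  rw [← card_compl, ← card_powersetCard]
  refine card_nbij' (· \ t) (· ∪ t) ?_ ?_ ?_ ?_
  · intro A hA
    simp only [coe_filter, mem_powersetCard, Set.mem_ofPred_eq] at hA
    simp only [mem_coe, mem_powersetCard]
    refine ⟨fun x hx => ?_, ?_⟩
    · simp_all
    · rw [card_sdiff_of_subset hA.2, hA.1.2]
  · intro A hA
    simp only [mem_coe, mem_powersetCard] at hA
    simp only [coe_filter, mem_powersetCard, Set.mem_ofPred_eq]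
    refine ⟨⟨subset_univ _, ?_⟩, subset_union_right⟩
    rw [card_union_of_disjoint (subset_compl_iff_disjoint_right.1 hA.1), hA.2]
    omega
  · intro A hA
    simp only [coe_filter, Set.mem_ofPred_eq] at hA
    exact sdiff_union_of_subset hA.2
  · intro A hA
    simp only [mem_coe, mem_powersetCard] at hA
    exact union_sdiff_cancel_right (subset_compl_iff_disjoint_right.1 hA.1)

theorem le_choose_add_succ (e d : ℕ) : e ≤ (e + d).choose (d + 1) := by
  induction d with
  | zero => simp
  | succ d ih =>
    rw [← add_assoc, Nat.choose_succ_succ]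
    omega

/-- The linear lower bound for binomial coefficients. -/
theorem one_add_mul_le_choose (e d : ℕ) : 1 + d * e ≤ (e + d).choose d := by
  induction d with
  | zero => simp
  | succ d ih =>
    have h := le_choose_add_succ e d
    rw [← add_assoc, Nat.choose_succ_succ]
    linarith

/-- The lower bound on the total storage, in division-free form. -/
theorem isCBC.mul_le {n r e : ℕ} (he : 1 ≤ e) {S : Fin (r + e) → Finset (Fin n)}
    (hS : isCBC n (r + e) (r + 1) 1 S) :
    n + n * r * e ≤ r * (r + e).choose r + (∑ i, #(S i)) * e := by
  let B : Fin n → Finset (Fin (r + e)) := fun x => {i | x ∈ S i}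
  have hN : ∑ i, #(S i) = ∑ x, #(B x) := by
    rw [← sum_card_filter_mem_comm]
  have hblock : ∀ x, 1 + r * e ≤ #{A ∈ powersetCard r univ | B x ⊆ A} + #(B x) * e := by
    intro x
    rcases le_or_gt #(B x) r with h | h
    · obtain ⟨d, hd⟩ := Nat.exists_eq_add_of_le h
      rw [card_filter_subset_powersetCard _ h, Fintype.card_fin]
      have h1 : r + e - #(B x) = e + d := by omega
      have h2 : r - #(B x) = d := by omega
      rw [h1, h2]
      have h3 := one_add_mul_le_choose e d
      have h4 : r * e = #(B x) * e + d * e := by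
        rw [← add_mul, ← hd]
      omega
    · have h1 : (r + 1) * e ≤ #(B x) * e := Nat.mul_le_mul_right e h
      rw [add_mul] at h1
      omega
  have hcount : ∑ x, #{A ∈ powersetCard r univ | B x ⊆ A} ≤ r * (r + e).choose r := by
    have hcomm := sum_card_bipartiteAbove_eq_sum_card_bipartiteBelow
      (s := (univ : Finset (Fin n))) (t := powersetCard r univ) (fun x A => B x ⊆ A)
    simp only [bipartiteAbove, bipartiteBelow] at hcomm
    rw [hcomm]
    refine (sum_le_card_nsmul _ _ r ?_).trans ?_
    · intro A hA
      have hA' := (mem_powersetCard.1 hA).2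
      exact (hS.card_filter_subset_le A (by omega)).trans hA'.le
    · simp [mul_comm]
  have hsum := sum_le_sum fun x (_ : x ∈ (univ : Finset (Fin n))) => hblock x
  simp only [sum_add_distrib, ← sum_mul, ← hN, sum_const, card_univ, Fintype.card_fin,
    smul_eq_mul] at hsum
  nlinarith

/-- A batch code with `p` blocks of size `r - 1` and `n - p` blocks of size `r`. -/
theorem exists_isCBC_of_mul_le {n r e p : ℕ} (hr : 1 ≤ r) (hpn : p ≤ n)
    (hp : p ≤ (r + e).choose (r - 1)) (hp0 : r = 1 → p = 0)
    (hcap : n + p * e ≤ r * (r + e).choose r) :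
    ∃ S : Fin (r + e) → Finset (Fin n),
      isCBC n (r + e) (r + 1) 1 S ∧ ∑ i, #(S i) = n * r - p := by
  obtain ⟨T, hT, hTp⟩ := exists_subset_card_eq
    (s := powersetCard (r - 1) (univ : Finset (Fin (r + e)))) (n := p) (by simpa using hp)
  have hTcard : ∀ t ∈ T, #t = r - 1 := fun t ht => (mem_powersetCard.1 (hT ht)).2
  let c : Finset (Fin (r + e)) → ℕ := fun A => #{t ∈ T | t ⊆ A}
  have hc : ∀ A : Finset (Fin (r + e)), #A = r → c A ≤ r := by
    intro A hA
    have hsub : ({t ∈ T | t ⊆ A} : Finset _) ⊆ powersetCard (r - 1) A := by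
      intro t ht
      obtain ⟨ht, htA⟩ := mem_filter.1 ht
      exact mem_powersetCard.2 ⟨htA, hTcard t ht⟩
    refine (card_le_card hsub).trans ?_
    rw [card_powersetCard, hA, Nat.choose_symm hr, Nat.choose_one_right]
  have hcsum : ∑ A ∈ powersetCard r univ, c A = p * (e + 1) := by
    have hcomm := sum_card_bipartiteAbove_eq_sum_card_bipartiteBelow
      (s := T) (t := powersetCard r univ) (fun t A => t ⊆ A)
    simp only [bipartiteAbove, bipartiteBelow] at hcomm
    change ∑ A ∈ powersetCard r univ, #{t ∈ T | t ⊆ A} = _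
    rw [← hcomm, sum_const_nat (m := e + 1), hTp]
    intro t ht
    have ht' := hTcard t ht
    rw [card_filter_subset_powersetCard t (by omega), ht', Fintype.card_fin]
    have h1 : r + e - (r - 1) = e + 1 := by omega
    have h2 : r - (r - 1) = 1 := by omega
    rw [h1, h2, Nat.choose_one_right]
  have hcap' : n - p ≤ #((powersetCard r univ).sigma fun A => range (r - c A)) := by
    have hsplit : ∑ A ∈ powersetCard r (univ : Finset (Fin (r + e))), (r - c A)
        + ∑ A ∈ powersetCard r univ, c A = r * (r + e).choose r := by
      rw [← sum_add_distrib, sum_const_nat (m := r)]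
      · simp [mul_comm]
      · intro A hA
        exact Nat.sub_add_cancel (hc A (mem_powersetCard.1 hA).2)
    rw [hcsum, mul_add] at hsplit
    rw [card_sigma]
    simp only [card_range]
    omega
  obtain ⟨W, hW, hWcard⟩ := exists_subset_card_eq hcap'
  have hWmem : ∀ w ∈ W, #w.1 = r ∧ w.2 < r - c w.1 := by
    intro w hw
    have h := mem_sigma.1 (hW hw)
    exact ⟨(mem_powersetCard.1 h.1).2, mem_range.1 h.2⟩
  let B : T ⊕ W → Finset (Fin (r + e)) := Sum.elim (fun t => t.1) fun w => w.1.1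
  have hcardB : ∀ A, #{x | B x ⊆ A} = c A + #{w ∈ W | w.1 ⊆ A} := by
    intro A
    rw [card_filter, Fintype.sum_sum_type]
    exact congrArg₂ (· + ·)
      ((sum_coe_sort T fun t => if t ⊆ A then 1 else 0).trans (card_filter _ _).symm)
      ((sum_coe_sort W fun w => if w.1 ⊆ A then 1 else 0).trans (card_filter _ _).symm)
  obtain ⟨S, hS, hN⟩ := exists_isCBC_of_blocks (n := n) (k := r + 1)
    (by simp [hTp, hWcard]; omega) B (by
      intro A hA
      rw [hcardB]
      rcases Nat.lt_or_ge #A r with h | h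
      · have hW0 : #{w ∈ W | w.1 ⊆ A} = 0 := by
          rw [card_eq_zero, filter_eq_empty_iff]
          intro w hw hwA
          have h1 := card_le_card hwA
          have h2 := (hWmem w hw).1
          omega
        rw [hW0, add_zero]
        have hsub : ({t ∈ T | t ⊆ A} : Finset _) ⊆ {A} := by
          intro t ht
          obtain ⟨ht, htA⟩ := mem_filter.1 ht
          have h1 := hTcard t ht
          exact mem_singleton.2 (eq_of_subset_of_card_le htA (by omega))
        have hc1 : c A ≤ 1 := card_le_card hsub
        have hcp : c A ≤ p := hTp ▸ card_filter_le _ _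
        by_contra! hlt
        have hA0 : #A = 0 := by omega
        have hpos : 0 < c A := by omega
        obtain ⟨t, ht⟩ := card_pos.1 hpos
        obtain ⟨ht, htA⟩ := mem_filter.1 ht
        have h1 := hTcard t ht
        have h2 := card_le_card htA
        have h3 := hp0 (by omega)
        omega
      · have hAr : #A = r := by omega
        have hWA : #{w ∈ W | w.1 ⊆ A} ≤ r - c A := by
          rw [← card_range (r - c A)]
          have key : ∀ w ∈ ({w ∈ W | w.1 ⊆ A} : Finset _), w.1 = A ∧ w.2 < r - c A := by
            intro w hw
            obtain ⟨hw, hwA⟩ := mem_filter.1 hw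
            obtain ⟨h1, h2⟩ := hWmem w hw
            have h3 : w.1 = A := eq_of_subset_of_card_le hwA (by omega)
            exact ⟨h3, h3 ▸ h2⟩
          refine card_le_card_of_injOn (fun w => w.2) ?_ ?_
          · intro w hw
            simpa using (key w hw).2
          · intro w hw v hv hwv
            exact Sigma.ext ((key w hw).1.trans (key v hv).1.symm) (heq_of_eq hwv)
        have := hc A hAr
        omega)
  refine ⟨S, hS, ?_⟩
  have hT' : ∑ t : T, #t.1 = p * (r - 1) := by
    rw [sum_const_nat (m := r - 1) fun t _ => hTcard t.1 t.2]
    simp [hTp]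
  have hW' : ∑ w : W, #w.1.1 = (n - p) * r := by
    rw [sum_const_nat (m := r) fun w _ => (hWmem w.1 w.2).1]
    simp [hWcard]
  rw [hN, Fintype.sum_sum_type]
  simp only [B, Sum.elim_inl, Sum.elim_inr]
  rw [hT', hW']
  obtain ⟨q, rfl⟩ := Nat.exists_eq_add_of_le hpn
  obtain ⟨s, rfl⟩ := Nat.exists_eq_add_of_le hr
  rw [Nat.add_sub_cancel_left, Nat.add_sub_cancel_left]
  apply Nat.eq_sub_of_add_eq
  ring

/-- If `2 ≤ k ≤ m` and `C(m,k−2) ≤ n ≤ (k−1)·C(m,k−1)`, the minimum total storage over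
all `CBC(n,m,k,1)` systems equals `n(k−1) − ⌊((k−1)·C(m,k−1) − n)/(m−k+1)⌋`. -/
theorem cbc_min_storage_middle_n (n m k : ℕ)
    (hk : 2 ≤ k) (hkm : k ≤ m) (hmn : m ≤ n)
    (hn1 : Nat.choose m (k - 2) ≤ n) (hn2 : n ≤ (k - 1) * Nat.choose m (k - 1)) :
    (∃ S : Fin m → Finset (Fin n), isCBC n m k 1 S ∧
        ∑ i, (S i).card =
          n * (k - 1) - ((k - 1) * Nat.choose m (k - 1) - n) / (m - k + 1)) ∧
    (∀ S : Fin m → Finset (Fin n), isCBC n m k 1 S →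
        n * (k - 1) - ((k - 1) * Nat.choose m (k - 1) - n) / (m - k + 1) ≤
          ∑ i, (S i).card) := by
  obtain ⟨s, rfl⟩ := Nat.exists_eq_add_of_le' hk
  obtain ⟨f, rfl⟩ := Nat.exists_eq_add_of_le hkm
  have hidx : s + 2 + f = s + 1 + (f + 1) := by omega
  have hden : s + 2 + f - (s + 2) + 1 = f + 1 := by omega
  rw [hden]
  rw [hidx] at hmn hn1 hn2 ⊢
  have hk1 : s + 2 - 1 = s + 1 := by omega
  have hk2 : s + 2 - 2 = s := by omega
  rw [hk1] at hn2 ⊢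
  rw [hk2] at hn1
  have hpascal : (s + 1) * (s + 1 + (f + 1)).choose (s + 1)
      = (f + 2) * (s + 1 + (f + 1)).choose s := by
    have h := Nat.choose_succ_right_eq (s + 1 + (f + 1)) s
    have h' : s + 1 + (f + 1) - s = f + 2 := by omega
    rw [h'] at h
    linarith
  refine ⟨?_, ?_⟩
  · have hple : ((s + 1) * (s + 1 + (f + 1)).choose (s + 1) - n) / (f + 1)
        ≤ (s + 1 + (f + 1)).choose s := by
      refine Nat.div_le_of_le_mul ?_
      rw [hpascal]
      have h : (f + 2) * (s + 1 + (f + 1)).choose s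
        = (f + 1) * (s + 1 + (f + 1)).choose s + (s + 1 + (f + 1)).choose s := by ring
      omega
    refine exists_isCBC_of_mul_le (by omega) (hple.trans hn1) (by simpa using hple) ?_ ?_
    · intro h
      obtain rfl : s = 0 := by omega
      have h0 : (0 + 1) * (0 + 1 + (f + 1)).choose (0 + 1) - n = 0 := by
        simp only [zero_add, Nat.choose_one_right]
        omega
      rw [h0, Nat.zero_div]
    · have h := Nat.div_mul_le_self ((s + 1) * (s + 1 + (f + 1)).choose (s + 1) - n) (f + 1)
      omega
  · intro S hS
    have h := hS.mul_le (by omega)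
    rw [Nat.sub_le_iff_le_add', ← Nat.sub_le_iff_le_add,
      Nat.le_div_iff_mul_le (Nat.add_one_pos f), Nat.sub_mul]
    omega
end

section
/- If n ≥ k and m ≥ k + r, then the minimum total storage over all consecutive ECBC(n,m,k,1,r) systems (t = 1) equals (r+1)n; that is, a consecutive ECBC(n,m,k,1,r) with total storage (r+1)n exists, and every consecutive ECBC(n,m,k,1,r) has total storage at least (r+1)n. -/
/-- An `m × n` storage system `S` is a consecutive `ECBC(n,m,k,t,r)` if for every set of
at most `k` files with consecutive indices `{a, a+1, …, b}` and every set `J` of servers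
with `|J| ≥ m − r`, there exist sets `C j ⊆ S j` for `j ∈ J` with `|C j| ≤ t` whose union
is `{a, a+1, …, b}`. -/
def isConsecutiveECBC (n m k t r : ℕ) (S : Fin m → Finset (Fin n)) : Prop :=
  ∀ a b : Fin n, a ≤ b → (b : ℕ) - (a : ℕ) + 1 ≤ k →
    ∀ J : Finset (Fin m), m - r ≤ J.card →
      ∃ C : Fin m → Finset (Fin n),
        (∀ j ∈ J, C j ⊆ S j ∧ (C j).card ≤ t) ∧ J.biUnion C = Finset.Icc a b

/-- The total storage equals the total number of replicas of the files. -/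
theorem sum_card_eq_sum_card_filter_mem {n m : ℕ} (S : Fin m → Finset (Fin n)) :
    ∑ i, (S i).card = ∑ x, (Finset.univ.filter fun i => x ∈ S i).card := by
  have h := Finset.sum_card_bipartiteAbove_eq_sum_card_bipartiteBelow
    (s := (Finset.univ : Finset (Fin m))) (t := (Finset.univ : Finset (Fin n)))
    (fun i x => x ∈ S i)
  simpa [Finset.bipartiteAbove, Finset.bipartiteBelow] using h

/-- Every file of a consecutive ECBC is stored on more than `r` servers. -/
theorem isConsecutiveECBC.lt_card_filter_mem {n m k t r : ℕ} {S : Fin m → Finset (Fin n)}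
    (hS : isConsecutiveECBC n m k t r S) (hk : 1 ≤ k) (x : Fin n) :
    r < (Finset.univ.filter fun i => x ∈ S i).card := by
  by_contra! h
  obtain ⟨C, hC, hU⟩ := hS x x le_rfl (by simpa using hk)
    (Finset.univ.filter fun i => x ∈ S i)ᶜ (by
      rw [Finset.card_compl, Fintype.card_fin]; omega)
  have hx : x ∈ Finset.Icc x x := by simp
  rw [← hU, Finset.mem_biUnion] at hx
  obtain ⟨j, hj, hxj⟩ := hx
  have := (hC j hj).1 hxj
  simp [this] at hj

/-- A system of distinct available servers, one for each file of every batch, witnesses the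
consecutive ECBC property with `t = 1`. -/
theorem isConsecutiveECBC_one_of_injOn {n m k r : ℕ} {S : Fin m → Finset (Fin n)}
    (h : ∀ a b : Fin n, a ≤ b → (b : ℕ) - (a : ℕ) + 1 ≤ k →
      ∀ J : Finset (Fin m), m - r ≤ J.card →
        ∃ f : Fin n → Fin m, Set.InjOn f (Finset.Icc a b) ∧
          ∀ x ∈ Finset.Icc a b, f x ∈ J ∧ x ∈ S (f x)) :
    isConsecutiveECBC n m k 1 r S := by
  intro a b hab hb J hJ
  obtain ⟨f, hf, hfJ⟩ := h a b hab hb J hJ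
  refine ⟨fun j => (Finset.Icc a b).filter fun x => f x = j, fun j _ => ⟨?_, ?_⟩, ?_⟩
  · intro x hx
    rw [Finset.mem_filter] at hx
    exact hx.2 ▸ (hfJ x hx.1).2
  · rw [Finset.card_le_one]
    intro x hx y hy
    rw [Finset.mem_filter] at hx hy
    exact hf hx.1 hy.1 (hx.2.trans hy.2.symm)
  · ext x
    simp only [Finset.mem_biUnion, Finset.mem_filter]
    exact ⟨fun ⟨_, _, hx, _⟩ => hx, fun hx => ⟨f x, (hfJ x hx).1, hx, rfl⟩⟩

/-- The number of positions below `p` satisfying `P` and those violating it add up to `p`. -/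
theorem count_add_count_not (P : ℕ → Prop) [DecidablePred P] (p : ℕ) :
    Nat.count P p + Nat.count (fun q => ¬ P q) p = p := by
  rw [Nat.count_eq_card_filter_range, Nat.count_eq_card_filter_range,
    Finset.card_filter_add_card_filter_not, Finset.card_range]

/-- If at most `r` positions below `m` violate `P`, then for `i + r < m` the `i`-th position
satisfying `P` lies in the window `[i, i + r]`. -/
theorem nth_mem_window {P : ℕ → Prop} [DecidablePred P] {m r i : ℕ}
    (hP : Nat.count (fun q => ¬ P q) m ≤ r) (hi : i + r < m) :
    P (Nat.nth P i) ∧ i ≤ Nat.nth P i ∧ Nat.nth P i ≤ i + r ∧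
      Nat.count P (Nat.nth P i) = i := by
  have hcount : i < Nat.count P m := by
    have := count_add_count_not P m
    omega
  have hlt : Nat.nth P i < m := Nat.nth_lt_of_lt_count hcount
  have hfin : ∀ hf : (Set.ofPred P).Finite, i < hf.toFinset.card := fun hf =>
    hcount.trans_le (Nat.count_le_card hf m)
  have hc : Nat.count P (Nat.nth P i) = i := Nat.count_nth hfin
  have hadd := count_add_count_not P (Nat.nth P i)
  have hmono := Nat.count_monotone (fun q => ¬ P q) hlt.le
  exact ⟨Nat.nth_mem i hfin, by omega, by omega, hc⟩

/-- Translations modulo `m` are injective on `{0, …, m - 1}`. -/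
theorem add_mod_inj {m a p q : ℕ} (hp : p < m) (hq : q < m)
    (h : (a + p) % m = (a + q) % m) : p = q := by
  have h' : p ≡ q [MOD m] := Nat.ModEq.add_left_cancel' a h
  exact Nat.ModEq.eq_of_lt_of_lt h' hp hq

open Classical in
/-- The cyclic storage system: file `x` is stored on the servers `x, x + 1, …, x + r`
modulo `m`. -/
def cyclicSystem (n m r : ℕ) (j : Fin m) : Finset (Fin n) :=
  Finset.univ.filter fun x => ∃ d ≤ r, ((x : ℕ) + d) % m = j

theorem mem_cyclicSystem {n m r : ℕ} {j : Fin m} {x : Fin n} :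
    x ∈ cyclicSystem n m r j ↔ ∃ d ≤ r, ((x : ℕ) + d) % m = j := by
  simp [cyclicSystem]

theorem sum_card_cyclicSystem {n m r : ℕ} (hr : r < m) :
    ∑ i, (cyclicSystem n m r i).card = (r + 1) * n := by
  have hm : 0 < m := by omega
  rw [sum_card_eq_sum_card_filter_mem]
  have hcard : ∀ x : Fin n,
      (Finset.univ.filter fun i => x ∈ cyclicSystem n m r i).card = r + 1 := by
    intro x
    have himage : (Finset.univ.filter fun i => x ∈ cyclicSystem n m r i) =
        (Finset.range (r + 1)).image fun d => (⟨((x : ℕ) + d) % m, Nat.mod_lt _ hm⟩ : Fin m) := by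
      ext i
      simp [mem_cyclicSystem, Fin.ext_iff]
    rw [himage, Finset.card_image_of_injOn, Finset.card_range]
    intro p hp q hq hpq
    simp only [Finset.coe_range, Set.mem_Iio] at hp hq
    exact add_mod_inj (by omega) (by omega) (Fin.ext_iff.mp hpq)
  simp [hcard, mul_comm]

theorem isConsecutiveECBC_cyclicSystem {n m k r : ℕ} (hm0 : 0 < m) (hm : k + r ≤ m) :
    isConsecutiveECBC n m k 1 r (cyclicSystem n m r) := by
  classical
  refine isConsecutiveECBC_one_of_injOn fun a b _ hb J hJ => ?_
  let server : ℕ → Fin m := fun p => ⟨((a : ℕ) + p) % m, Nat.mod_lt _ hm0⟩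
  let P : ℕ → Prop := fun p => server p ∈ J
  have hP : Nat.count (fun q => ¬ P q) m ≤ r := by
    rw [Nat.count_eq_card_filter_range]
    calc ((Finset.range m).filter fun q => ¬ P q).card ≤ Jᶜ.card := by
          refine Finset.card_le_card_of_injOn server (fun p hp => ?_) (fun p hp q hq hpq => ?_)
          · simpa [P] using (Finset.mem_filter.mp hp).2
          · simp only [Finset.coe_filter, Finset.mem_range, Set.mem_ofPred_eq] at hp hq
            exact add_mod_inj hp.1 hq.1 (Fin.ext_iff.mp hpq)
      _ ≤ r := by rw [Finset.card_compl, Fintype.card_fin]; omega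
  have hwin : ∀ x ∈ Finset.Icc a b, (a : ℕ) ≤ x ∧ (x : ℕ) - a + r < m := by
    intro x hx
    rw [Finset.mem_Icc, Fin.le_def, Fin.le_def] at hx
    omega
  refine ⟨fun x => server (Nat.nth P ((x : ℕ) - a)), fun x hx y hy hxy => ?_, fun x hx => ?_⟩
  · obtain ⟨hax, hxm⟩ := hwin x hx
    obtain ⟨hay, hym⟩ := hwin y hy
    obtain ⟨-, -, hx1, hx2⟩ := nth_mem_window hP hxm
    obtain ⟨-, -, hy1, hy2⟩ := nth_mem_window hP hym
    have heq := add_mod_inj (by omega) (by omega) (Fin.ext_iff.mp hxy)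
    rw [heq, hy2] at hx2
    exact Fin.ext (by omega)
  · obtain ⟨hax, hxm⟩ := hwin x hx
    obtain ⟨hmem, hle, hge, -⟩ := nth_mem_window hP hxm
    refine ⟨hmem, mem_cyclicSystem.mpr ⟨Nat.nth P ((x : ℕ) - a) - (x - a), by omega, ?_⟩⟩
    change _ = ((a : ℕ) + Nat.nth P ((x : ℕ) - a)) % m
    congr 1
    omega

/-- If `n ≥ k` and `m ≥ k + r`, the minimum total storage over all consecutive
`ECBC(n,m,k,1,r)` systems equals `(r+1)·n`. -/
theorem consecutive_ecbc_min_storage_t_one (n m k r : ℕ)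
    (hn : 1 ≤ n) (hm' : 1 ≤ m) (hk : 1 ≤ k) (hkn : k ≤ n) (hm : k + r ≤ m) :
    (∃ S : Fin m → Finset (Fin n), isConsecutiveECBC n m k 1 r S ∧
        ∑ i, (S i).card = (r + 1) * n) ∧
    (∀ S : Fin m → Finset (Fin n), isConsecutiveECBC n m k 1 r S →
        (r + 1) * n ≤ ∑ i, (S i).card) := by
  refine ⟨⟨cyclicSystem n m r, isConsecutiveECBC_cyclicSystem hm' hm,
    sum_card_cyclicSystem (by omega)⟩, fun S hS => ?_⟩
  rw [sum_card_eq_sum_card_filter_mem]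
  calc (r + 1) * n = ∑ _x : Fin n, (r + 1) := by simp [mul_comm]
    _ ≤ _ := Finset.sum_le_sum fun x _ => hS.lt_card_filter_mem hk x
end
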